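/- arXiv:1706.06892 — 4 statements merged into one kernel-verified Lean document; each statement's English description precedes it below -/
import Mathlib

section
/- Let μ and p satisfy assumption (H1), assume μ((0,1]) > 0, and let N ≥ 1 be an integer. Set α_{−,N} = ∫_{(0,1]} z(1 − e^{−Nz}) μ(dz) (which is finite and strictly positive), and define h_{−,N}(s) = s + (N α_{−,N})^{−1} ∫_{(0,1]} (e^{−N(1−s)z} − 1 + N(1−s)z) μ(dz) for s ∈ [−1,1]. Define q₀^{−,N} = (N α_{−,N})^{−1} ∫_{(0,1]} (e^{−Nz} − 1 + Nz) μ(dz), q₁^{−,N} = 0, and q_k^{−,N} = (k! · N α_{−,N})^{−1} ∫_{(0,1]} (Nz)^k e^{−Nz} μ(dz) for k ≥ 2. Then every q_k^{−,N} ≥ 0, Σ_{k≥0} q_k^{−,N} = 1, and h_{−,N}(s) = Σ_{k≥0} q_k^{−,N} s^k for all s ∈ [−1,1]; in particular h_{−,N} is a probability generating function with h_{−,N}(1) = 1. -/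
open Real Set MeasureTheory

/-- The integrands whose integrals are, up to normalization, the coefficients of the generating
function. -/
noncomputable def coeffIntegrand (c : ℝ) : ℕ → ℝ → ℝ
  | 0, z => exp (-c * z) - 1 + c * z
  | 1, _ => 0
  | k + 2, z => (c * z) ^ (k + 2) * exp (-c * z) / (k + 2).factorial

theorem exp_neg_sub_one_add_self_nonneg (x : ℝ) : 0 ≤ exp (-x) - 1 + x := by
  linarith [add_one_le_exp (-x)]

theorem exp_neg_sub_one_add_self_le_sq {x : ℝ} (hx : 0 ≤ x) : exp (-x) - 1 + x ≤ x ^ 2 := by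
  have h1 : exp (-x) * (1 + x) ≤ 1 := by
    calc exp (-x) * (1 + x) ≤ exp (-x) * exp x := by
          gcongr
          linarith [add_one_le_exp x]
      _ = 1 := by rw [← exp_add]; simp
  have h2 : (exp (-x) - 1 + x - x ^ 2) * (1 + x) ≤ 0 := by
    nlinarith [pow_nonneg hx 3]
  nlinarith

theorem coeffIntegrand_nonneg {c z : ℝ} (hc : 0 ≤ c) (hz : 0 ≤ z) (k : ℕ) :
    0 ≤ coeffIntegrand c k z := by
  match k with
  | 0 => simpa [coeffIntegrand] using exp_neg_sub_one_add_self_nonneg (c * z)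
  | 1 => simp [coeffIntegrand]
  | k + 2 => simp only [coeffIntegrand]; positivity

theorem continuous_coeffIntegrand (c : ℝ) (k : ℕ) : Continuous (coeffIntegrand c k) := by
  match k with
  | 0 => change Continuous fun z => exp (-c * z) - 1 + c * z; fun_prop
  | 1 => exact continuous_const
  | k + 2 =>
    change Continuous fun z => (c * z) ^ (k + 2) * exp (-c * z) / (k + 2).factorial
    fun_prop

theorem hasSum_coeffIntegrand (c z s : ℝ) :
    HasSum (fun k => coeffIntegrand c k z * s ^ k)
      (exp (-(c * (1 - s)) * z) - 1 + c * (1 - s) * z + s * c * (z * (1 - exp (-c * z)))) := by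
  have h1 : HasSum (fun k : ℕ => exp (-c * z) * ((c * z * s) ^ k / k.factorial))
      (exp (-c * z) * exp (c * z * s)) := by
    rw [exp_eq_exp_ℝ]
    exact (NormedSpace.expSeries_div_hasSum_exp (c * z * s)).mul_left _
  have h2 := (h1.add (hasSum_ite_eq 0 (-1 + c * z))).add
    (hasSum_ite_eq 1 (-(exp (-c * z) * (c * z * s))))
  convert h2 using 1
  · funext k
    match k with
    | 0 => simp [coeffIntegrand]; ring
    | 1 => simp [coeffIntegrand]
    | k + 2 => simp [coeffIntegrand, mul_pow]; ring
  · rw [← exp_add, show -(c * (1 - s)) * z = -c * z + c * z * s by ring]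
    ring

theorem hasSum_coeffIntegrand_one (c z : ℝ) :
    HasSum (fun k => coeffIntegrand c k z) (c * (z * (1 - exp (-c * z)))) := by
  simpa using hasSum_coeffIntegrand c z 1

theorem integrableOn_sq_of_min {μ : Measure ℝ} {p : ℝ} (hp : p ≤ 2)
    (hμ : IntegrableOn (fun z : ℝ => min (z ^ p) (z ^ 2)) (Ioi 0) μ) :
    IntegrableOn (fun z : ℝ => z ^ 2) (Ioc 0 1) μ := by
  refine (hμ.mono_set Ioc_subset_Ioi_self).congr_fun (fun z hz => ?_) measurableSet_Ioc
  refine min_eq_right ?_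
  simpa using rpow_le_rpow_of_exponent_ge hz.1 hz.2 hp

theorem integrableOn_exp_neg_sub_one_add {μ : Measure ℝ}
    (hμ : IntegrableOn (fun z : ℝ => z ^ 2) (Ioc 0 1) μ)
    {c : ℝ} (hc : 0 ≤ c) :
    IntegrableOn (fun z => exp (-c * z) - 1 + c * z) (Ioc 0 1) μ := by
  refine (hμ.const_mul (c ^ 2)).mono' (by fun_prop) ?_
  filter_upwards [ae_restrict_mem measurableSet_Ioc] with z hz
  rw [neg_mul, norm_of_nonneg (exp_neg_sub_one_add_self_nonneg _), ← mul_pow]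
  exact exp_neg_sub_one_add_self_le_sq (mul_nonneg hc hz.1.le)

theorem integrableOn_mul_one_sub_exp {μ : Measure ℝ}
    (hμ : IntegrableOn (fun z : ℝ => z ^ 2) (Ioc 0 1) μ)
    {c : ℝ} (hc : 0 ≤ c) :
    IntegrableOn (fun z => z * (1 - exp (-c * z))) (Ioc 0 1) μ := by
  refine (hμ.const_mul c).mono' (by fun_prop) ?_
  filter_upwards [ae_restrict_mem measurableSet_Ioc] with z hz
  have h0 : 0 ≤ c * z := mul_nonneg hc hz.1.le
  have h1 : exp (-c * z) ≤ 1 := exp_le_one_iff.2 (by linarith)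
  rw [norm_of_nonneg (mul_nonneg hz.1.le (by linarith))]
  nlinarith [add_one_le_exp (-c * z), hz.1]

theorem setIntegral_mul_one_sub_exp_pos {μ : Measure ℝ}
    (hμ : IntegrableOn (fun z : ℝ => z ^ 2) (Ioc 0 1) μ) (hpos : 0 < μ (Ioc 0 1))
    {c : ℝ} (hc : 0 < c) : 0 < ∫ z in Ioc (0 : ℝ) 1, z * (1 - exp (-c * z)) ∂μ := by
  have key : ∀ z ∈ Ioc (0 : ℝ) 1, 0 < z * (1 - exp (-c * z)) := fun z hz => by
    have : exp (-c * z) < 1 := exp_lt_one_iff.2 (by nlinarith [mul_pos hc hz.1])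
    exact mul_pos hz.1 (by linarith)
  rw [setIntegral_pos_iff_support_of_nonneg_ae _ (integrableOn_mul_one_sub_exp hμ hc.le)]
  · rwa [inter_eq_right.2 fun z hz => Function.mem_support.2 (key z hz).ne']
  · filter_upwards [ae_restrict_mem measurableSet_Ioc] with z hz using (key z hz).le

theorem hasSum_setIntegral_coeffIntegrand {μ : Measure ℝ}
    (hμ : IntegrableOn (fun z : ℝ => z ^ 2) (Ioc 0 1) μ) {c s : ℝ} (hc : 0 ≤ c)
    (hs : s ∈ Icc (-1 : ℝ) 1) :
    HasSum (fun k => (∫ z in Ioc (0 : ℝ) 1, coeffIntegrand c k z ∂μ) * s ^ k)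
      ((∫ z in Ioc (0 : ℝ) 1, (exp (-(c * (1 - s)) * z) - 1 + c * (1 - s) * z) ∂μ) +
        s * c * ∫ z in Ioc (0 : ℝ) 1, z * (1 - exp (-c * z)) ∂μ) := by
  have hmul := integrableOn_mul_one_sub_exp hμ hc
  have hexp := integrableOn_exp_neg_sub_one_add hμ (mul_nonneg hc (sub_nonneg.2 hs.2))
  rw [← integral_const_mul, ← integral_add hexp (hmul.const_mul _)]
  simp_rw [← integral_mul_const]
  refine hasSum_integral_of_dominated_convergence (coeffIntegrand c) (fun k => ?_) (fun k => ?_)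
    ?_ ?_ ?_
  · exact ((continuous_coeffIntegrand c k).mul continuous_const).aestronglyMeasurable
  · filter_upwards [ae_restrict_mem measurableSet_Ioc] with z hz
    have h0 := coeffIntegrand_nonneg hc hz.1.le k
    rw [norm_mul, norm_of_nonneg h0, norm_pow]
    exact mul_le_of_le_one_right h0 (pow_le_one₀ (norm_nonneg s) (abs_le.2 hs))
  · exact .of_forall fun z => (hasSum_coeffIntegrand_one c z).summable
  · simp_rw [(hasSum_coeffIntegrand_one c _).tsum_eq]
    exact hmul.const_mul c
  · exact .of_forall fun z => hasSum_coeffIntegrand c z s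

/-- Under assumption (H1) with `μ((0,1]) > 0`, `h_{−,N}` is a probability generating
function with coefficients `q_k^{−,N}`. -/
theorem stmt3 (μ : Measure ℝ) [SigmaFinite μ] (p : ℝ) (hp1 : 1 < p) (hp2 : p < 2)
    (hμ : IntegrableOn (fun z : ℝ => min (z ^ p) (z ^ 2)) (Ioi 0) μ)
    (hpos : 0 < μ (Ioc 0 1)) (N : ℕ) (hN : 1 ≤ N)
    (α : ℝ) (hα : α = ∫ z in Ioc (0 : ℝ) 1, z * (1 - Real.exp (-(N : ℝ) * z)) ∂μ)
    (h : ℝ → ℝ)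
    (hh : ∀ s : ℝ, h s = s + ((N : ℝ) * α)⁻¹ *
      ∫ z in Ioc (0 : ℝ) 1,
        (Real.exp (-((N : ℝ) * (1 - s)) * z) - 1 + (N : ℝ) * (1 - s) * z) ∂μ)
    (q : ℕ → ℝ)
    (hq0 : q 0 = ((N : ℝ) * α)⁻¹ *
      ∫ z in Ioc (0 : ℝ) 1, (Real.exp (-(N : ℝ) * z) - 1 + (N : ℝ) * z) ∂μ)
    (hq1 : q 1 = 0)
    (hqk : ∀ k : ℕ, 2 ≤ k → q k = ((k.factorial : ℝ) * ((N : ℝ) * α))⁻¹ *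
      ∫ z in Ioc (0 : ℝ) 1, ((N : ℝ) * z) ^ k * Real.exp (-(N : ℝ) * z) ∂μ) :
    0 < α ∧ (∀ k : ℕ, 0 ≤ q k) ∧ (∑' k : ℕ, q k) = 1 ∧
      (∀ s ∈ Icc (-1 : ℝ) 1, h s = ∑' k : ℕ, q k * s ^ k) ∧ h 1 = 1 := by
  have hsq := integrableOn_sq_of_min hp2.le hμ
  have hc : (0 : ℝ) < N := by exact_mod_cast hN
  have hα0 : 0 < α := hα ▸ setIntegral_mul_one_sub_exp_pos hsq hpos hc
  have hcα : 0 < (N : ℝ) * α := mul_pos hc hα0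
  have hq : ∀ k, q k = ((N : ℝ) * α)⁻¹ * ∫ z in Ioc (0 : ℝ) 1, coeffIntegrand N k z ∂μ := by
    intro k
    match k with
    | 0 => exact hq0
    | 1 => simp [hq1, coeffIntegrand]
    | k + 2 =>
      rw [hqk (k + 2) (by lia)]
      simp only [coeffIntegrand]
      rw [integral_div, mul_inv]
      ring
  have hsum : ∀ s ∈ Icc (-1 : ℝ) 1, HasSum (fun k => q k * s ^ k) (h s) := by
    intro s hs
    have key := (hasSum_setIntegral_coeffIntegrand hsq hc.le hs).mul_left ((N : ℝ) * α)⁻¹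
    rw [← hα] at key
    simp_rw [← mul_assoc _ _ (s ^ _), ← hq] at key
    have hval : h s = ((N : ℝ) * α)⁻¹ * ((∫ z in Ioc (0 : ℝ) 1,
        (exp (-((N : ℝ) * (1 - s)) * z) - 1 + (N : ℝ) * (1 - s) * z) ∂μ) + s * N * α) := by
      rw [hh]
      field_simp
      ring
    exact hval ▸ key
  have h1 : h 1 = 1 := by simp [hh]
  refine ⟨hα0, fun k => ?_, ?_, fun s hs => (hsum s hs).tsum_eq.symm, h1⟩
  · rw [hq]
    exact mul_nonneg (inv_nonneg.2 hcα.le) (setIntegral_nonneg measurableSet_Ioc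
      fun z hz => coeffIntegrand_nonneg hc.le hz.1.le k)
  · simpa [h1] using (hsum 1 (by simp)).tsum_eq
end

section
/- Let μ and p satisfy assumption (H1), assume μ((1,∞)) > 0, and let N ≥ 1 be an integer. Set α_{+,N} = ∫_{(1,∞)} z(1 − e^{−Nz}) μ(dz) (which is finite and strictly positive), and define h_{+,N}(s) = s + (N α_{+,N})^{−1} ∫_{(1,∞)} (e^{−N(1−s)z} − 1 + N(1−s)z) μ(dz) for s ∈ [−1,1]. Define q₀^{+,N} = (N α_{+,N})^{−1} ∫_{(1,∞)} (e^{−Nz} − 1 + Nz) μ(dz), q₁^{+,N} = 0, and q_k^{+,N} = (k! · N α_{+,N})^{−1} ∫_{(1,∞)} (Nz)^k e^{−Nz} μ(dz) for k ≥ 2. Then every q_k^{+,N} ≥ 0, Σ_{k≥0} q_k^{+,N} = 1, and h_{+,N}(s) = Σ_{k≥0} q_k^{+,N} s^k for all s ∈ [−1,1]; in particular h_{+,N} is a probability generating function with h_{+,N}(1) = 1. -/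
open Real Set MeasureTheory

/-- Poisson weights `x ^ k * e⁻ˣ / k!`, with the weight at `1` removed and the weight at `0`
increased by `x - 1`. -/
noncomputable def compensatedPoissonWeight : ℕ → ℝ → ℝ
  | 0, x => Real.exp (-x) - 1 + x
  | 1, _ => 0
  | k + 2, x => x ^ (k + 2) * Real.exp (-x) / ((k + 2).factorial : ℝ)

lemma compensatedPoissonWeight_nonneg {x : ℝ} (hx : 0 ≤ x) :
    ∀ k, 0 ≤ compensatedPoissonWeight k x
  | 0 => by
    have := Real.add_one_le_exp (-x)
    simp only [compensatedPoissonWeight]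
    linarith
  | 1 => le_rfl
  | k + 2 => by
    simp only [compensatedPoissonWeight]
    positivity

lemma continuous_compensatedPoissonWeight :
    ∀ k, Continuous (compensatedPoissonWeight k)
  | 0 => by
    unfold compensatedPoissonWeight
    fun_prop
  | 1 => continuous_const
  | k + 2 => by
    unfold compensatedPoissonWeight
    fun_prop

lemma hasSum_compensatedPoissonWeight_mul_pow (x s : ℝ) :
    HasSum (fun k => compensatedPoissonWeight k x * s ^ k)
      (s * (x * (1 - Real.exp (-x))) + (Real.exp (-((1 - s) * x)) - 1 + (1 - s) * x)) := by
  have hexp : HasSum (fun k : ℕ => Real.exp (-x) * ((x * s) ^ k / (k.factorial : ℝ)))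
      (Real.exp (-x) * Real.exp (x * s)) := by
    have := NormedSpace.expSeries_div_hasSum_exp (x * s)
    rw [← Real.exp_eq_exp_ℝ] at this
    exact this.mul_left _
  rw [← Real.exp_add, ← hasSum_nat_add_iff' 2] at hexp
  rw [← hasSum_nat_add_iff' 2]
  convert hexp using 1
  · funext k
    simp only [compensatedPoissonWeight]
    ring
  · have harg : -((1 - s) * x) = -x + x * s := by ring
    simp only [Finset.sum_range_succ, Finset.sum_range_zero, compensatedPoissonWeight, harg,
      Nat.factorial]
    push_cast
    ring

lemma integrableOn_Ioi_one_id_of_min_rpow_sq {μ : Measure ℝ} {p : ℝ} (hp1 : 1 < p) (hp2 : p < 2)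
    (hμ : IntegrableOn (fun z : ℝ => min (z ^ p) (z ^ 2)) (Ioi 0) μ) :
    IntegrableOn (fun z : ℝ => z) (Ioi 1) μ := by
  refine Integrable.mono' (hμ.mono_set (Ioi_subset_Ioi zero_le_one))
    measurable_id.aestronglyMeasurable ?_
  filter_upwards [ae_restrict_mem measurableSet_Ioi] with z hz
  have hz : 1 < z := hz
  rw [Real.norm_of_nonneg (by linarith)]
  refine le_min ?_ (by nlinarith)
  simpa using Real.rpow_le_rpow_of_exponent_le hz.le hp1.le

lemma integrableOn_Ioi_one_const {μ : Measure ℝ} (hμ : IntegrableOn (fun z : ℝ => z) (Ioi 1) μ)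
    (c : ℝ) : IntegrableOn (fun _ : ℝ => c) (Ioi 1) μ := by
  refine Integrable.mono' (hμ.const_mul |c|) aestronglyMeasurable_const ?_
  filter_upwards [ae_restrict_mem measurableSet_Ioi] with z hz
  have hz : 1 < z := hz
  rw [Real.norm_eq_abs]
  nlinarith [abs_nonneg c]

lemma integrableOn_Ioi_one_exp_neg_mul {μ : Measure ℝ}
    (hμ : IntegrableOn (fun z : ℝ => z) (Ioi 1) μ) {c : ℝ} (hc : 0 ≤ c) :
    IntegrableOn (fun z : ℝ => Real.exp (-(c * z))) (Ioi 1) μ := by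
  refine Integrable.mono' (integrableOn_Ioi_one_const hμ 1)
    (by fun_prop : Measurable _).aestronglyMeasurable ?_
  filter_upwards [ae_restrict_mem measurableSet_Ioi] with z hz
  have hz : 1 < z := hz
  rw [Real.norm_of_nonneg (Real.exp_pos _).le, Real.exp_le_one_iff]
  nlinarith

lemma integrableOn_Ioi_one_mul_one_sub_exp_neg_mul {μ : Measure ℝ}
    (hμ : IntegrableOn (fun z : ℝ => z) (Ioi 1) μ) {c : ℝ} (hc : 0 ≤ c) :
    IntegrableOn (fun z : ℝ => z * (1 - Real.exp (-(c * z)))) (Ioi 1) μ := by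
  refine Integrable.mono' hμ (by fun_prop : Measurable _).aestronglyMeasurable ?_
  filter_upwards [ae_restrict_mem measurableSet_Ioi] with z hz
  have hz : 1 < z := hz
  have hexp : Real.exp (-(c * z)) ≤ 1 := by
    rw [Real.exp_le_one_iff]
    nlinarith
  rw [Real.norm_of_nonneg (mul_nonneg (by linarith) (by linarith))]
  nlinarith [Real.exp_pos (-(c * z))]

lemma setIntegral_Ioi_one_mul_one_sub_exp_neg_mul_pos {μ : Measure ℝ}
    (hμ : IntegrableOn (fun z : ℝ => z) (Ioi 1) μ) (hpos : 0 < μ (Ioi 1)) {c : ℝ} (hc : 0 < c) :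
    0 < ∫ z in Ioi (1 : ℝ), z * (1 - Real.exp (-(c * z))) ∂μ := by
  have hval : ∀ z ∈ Ioi (1 : ℝ), 0 < z * (1 - Real.exp (-(c * z))) := by
    intro z hz
    have hz : 0 < z := zero_lt_one.trans hz
    have : Real.exp (-(c * z)) < 1 := by
      rw [Real.exp_lt_one_iff]
      nlinarith [mul_pos hc hz]
    exact mul_pos hz (by linarith)
  rw [setIntegral_pos_iff_support_of_nonneg_ae
    (by filter_upwards [ae_restrict_mem measurableSet_Ioi] with z hz using (hval z hz).le)
    (integrableOn_Ioi_one_mul_one_sub_exp_neg_mul hμ hc.le)]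
  rwa [inter_eq_right.mpr fun z hz => Function.mem_support.mpr (hval z hz).ne']

lemma integrableOn_Ioi_one_exp_neg_mul_sub_one_add {μ : Measure ℝ}
    (hμ : IntegrableOn (fun z : ℝ => z) (Ioi 1) μ) {c : ℝ} (hc : 0 ≤ c) :
    IntegrableOn (fun z : ℝ => Real.exp (-(c * z)) - 1 + c * z) (Ioi 1) μ :=
  ((integrableOn_Ioi_one_exp_neg_mul hμ hc).sub (integrableOn_Ioi_one_const hμ 1)).add
    (hμ.const_mul c)

lemma hasSum_setIntegral_compensatedPoissonWeight_mul_pow {μ : Measure ℝ}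
    (hμ : IntegrableOn (fun z : ℝ => z) (Ioi 1) μ) {c : ℝ} (hc : 0 ≤ c)
    {s : ℝ} (hs : s ∈ Icc (-1 : ℝ) 1) :
    HasSum (fun k => (∫ z in Ioi (1 : ℝ), compensatedPoissonWeight k (c * z) ∂μ) * s ^ k)
      (s * (c * ∫ z in Ioi (1 : ℝ), z * (1 - Real.exp (-(c * z))) ∂μ) +
        ∫ z in Ioi (1 : ℝ), (Real.exp (-(c * (1 - s) * z)) - 1 + c * (1 - s) * z) ∂μ) := by
  have hc' : 0 ≤ c * (1 - s) := mul_nonneg hc (by linarith [hs.2])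
  have key : HasSum
      (fun k => ∫ z in Ioi (1 : ℝ), compensatedPoissonWeight k (c * z) * s ^ k ∂μ)
      (∫ z in Ioi (1 : ℝ), (s * (c * (z * (1 - Real.exp (-(c * z))))) +
        (Real.exp (-(c * (1 - s) * z)) - 1 + c * (1 - s) * z)) ∂μ) := by
    refine hasSum_integral_of_dominated_convergence
      (fun k z => compensatedPoissonWeight k (c * z)) (fun k => ?_) (fun k => ?_) ?_ ?_ ?_
    · exact (((continuous_compensatedPoissonWeight k).comp
        (continuous_const_mul c)).mul_const _).aestronglyMeasurable
    · filter_upwards [ae_restrict_mem measurableSet_Ioi] with z hz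
      have hz : 0 < z := zero_lt_one.trans hz
      have hw := compensatedPoissonWeight_nonneg (mul_nonneg hc hz.le) k
      rw [norm_mul, Real.norm_of_nonneg hw, norm_pow, Real.norm_eq_abs]
      exact mul_le_of_le_one_right hw (pow_le_one₀ (abs_nonneg s) (abs_le.mpr hs))
    · refine .of_forall fun z => ?_
      simpa using (hasSum_compensatedPoissonWeight_mul_pow (c * z) 1).summable
    · have htsum : (fun z : ℝ => ∑' k, compensatedPoissonWeight k (c * z)) =
          fun z => c * (z * (1 - Real.exp (-(c * z)))) := by
        funext z
        simpa [mul_assoc] using (hasSum_compensatedPoissonWeight_mul_pow (c * z) 1).tsum_eq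
      rw [htsum]
      exact (integrableOn_Ioi_one_mul_one_sub_exp_neg_mul hμ hc).const_mul c
    · refine .of_forall fun z => ?_
      have hz := hasSum_compensatedPoissonWeight_mul_pow (c * z) s
      rw [show (1 - s) * (c * z) = c * (1 - s) * z by ring, mul_assoc c z] at hz
      exact hz
  rw [integral_add
    (((integrableOn_Ioi_one_mul_one_sub_exp_neg_mul hμ hc).const_mul c).const_mul s)
    (integrableOn_Ioi_one_exp_neg_mul_sub_one_add hμ hc'),
    integral_const_mul, integral_const_mul] at key
  simpa only [integral_mul_const] using key

/-- Under assumption (H1) with `μ((1,∞)) > 0`, `h_{+,N}` is a probability generating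
function with coefficients `q_k^{+,N}`. -/
theorem stmt4 (μ : Measure ℝ) [SigmaFinite μ] (p : ℝ) (hp1 : 1 < p) (hp2 : p < 2)
    (hμ : IntegrableOn (fun z : ℝ => min (z ^ p) (z ^ 2)) (Ioi 0) μ)
    (hpos : 0 < μ (Ioi 1)) (N : ℕ) (hN : 1 ≤ N)
    (α : ℝ) (hα : α = ∫ z in Ioi (1 : ℝ), z * (1 - Real.exp (-(N : ℝ) * z)) ∂μ)
    (h : ℝ → ℝ)
    (hh : ∀ s : ℝ, h s = s + ((N : ℝ) * α)⁻¹ *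
      ∫ z in Ioi (1 : ℝ),
        (Real.exp (-((N : ℝ) * (1 - s)) * z) - 1 + (N : ℝ) * (1 - s) * z) ∂μ)
    (q : ℕ → ℝ)
    (hq0 : q 0 = ((N : ℝ) * α)⁻¹ *
      ∫ z in Ioi (1 : ℝ), (Real.exp (-(N : ℝ) * z) - 1 + (N : ℝ) * z) ∂μ)
    (hq1 : q 1 = 0)
    (hqk : ∀ k : ℕ, 2 ≤ k → q k = ((k.factorial : ℝ) * ((N : ℝ) * α))⁻¹ *
      ∫ z in Ioi (1 : ℝ), ((N : ℝ) * z) ^ k * Real.exp (-(N : ℝ) * z) ∂μ) :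
    0 < α ∧ (∀ k : ℕ, 0 ≤ q k) ∧ (∑' k : ℕ, q k) = 1 ∧
      (∀ s ∈ Icc (-1 : ℝ) 1, h s = ∑' k : ℕ, q k * s ^ k) ∧ h 1 = 1 := by
  have hid := integrableOn_Ioi_one_id_of_min_rpow_sq hp1 hp2 hμ
  have hN0 : (0 : ℝ) < N := by exact_mod_cast hN
  simp only [neg_mul] at hα hh hq0 hqk
  have hαpos : 0 < α := hα ▸ setIntegral_Ioi_one_mul_one_sub_exp_neg_mul_pos hid hpos hN0
  have hNα : 0 < (N : ℝ) * α := mul_pos hN0 hαpos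
  have hq : ∀ k, q k = ((N : ℝ) * α)⁻¹ *
      ∫ z in Ioi (1 : ℝ), compensatedPoissonWeight k ((N : ℝ) * z) ∂μ := by
    rintro (_ | _ | k)
    · exact hq0
    · simpa [compensatedPoissonWeight] using hq1
    · rw [hqk _ (by omega)]
      simp only [compensatedPoissonWeight, integral_div]
      rw [mul_inv]
      ring
  have hsum : ∀ s ∈ Icc (-1 : ℝ) 1, HasSum (fun k => q k * s ^ k) (h s) := by
    intro s hs
    have key := (hasSum_setIntegral_compensatedPoissonWeight_mul_pow hid hN0.le hs).mul_left
      ((N : ℝ) * α)⁻¹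
    rw [← hα, mul_add, mul_left_comm, inv_mul_cancel₀ hNα.ne', mul_one, ← hh] at key
    simpa only [hq, mul_assoc] using key
  have h1 : h 1 = 1 := by simp [hh]
  refine ⟨hαpos, fun k => ?_, ?_, fun s hs => (hsum s hs).tsum_eq.symm, h1⟩
  · rw [hq]
    refine mul_nonneg (inv_nonneg.mpr hNα.le) (setIntegral_nonneg measurableSet_Ioi fun z hz => ?_)
    exact compensatedPoissonWeight_nonneg
      (mul_nonneg hN0.le (zero_lt_one.trans (mem_Ioi.mp hz)).le) k
  · simpa [h1] using (hsum 1 (by norm_num)).tsum_eq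
end

section
/- Let μ and p satisfy assumption (H1) and assume μ((1,∞)) > 0. For each integer N ≥ 1 set α_{+,N} = ∫_{(1,∞)} z(1−e^{−Nz}) μ(dz), q₀^{+,N} = (Nα_{+,N})^{−1}∫_{(1,∞)}(e^{−Nz}−1+Nz)μ(dz), q₁^{+,N} = 0, and q_k^{+,N} = (k!·Nα_{+,N})^{−1}∫_{(1,∞)}(Nz)^k e^{−Nz} μ(dz) for k ≥ 2. Then there exists a constant C₂ > 0 (depending only on p and ∫_{(1,∞)} z^p μ(dz)) such that for all integers N ≥ 1: N α_{+,N} · Σ_{k≥0} |(k−1)/N|^p q_k^{+,N} ≤ C₂. -/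
open Real Set MeasureTheory

/-- The unnormalised offspring weights at a single atom, with `x = N z`. -/
noncomputable def offspringWeight (k : ℕ) (x : ℝ) : ℝ :=
  if k = 0 then exp (-x) - 1 + x else (k.factorial : ℝ)⁻¹ * (x ^ k * exp (-x))

lemma offspringWeight_nonneg (k : ℕ) {x : ℝ} (hx : 0 ≤ x) : 0 ≤ offspringWeight k x := by
  unfold offspringWeight
  split_ifs
  · linarith [add_one_le_exp (-x)]
  · positivity

lemma measurable_offspringWeight (k : ℕ) : Measurable (offspringWeight k) := by
  unfold offspringWeight
  split_ifs <;> fun_prop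

lemma hasSum_pow_div_factorial (x : ℝ) :
    HasSum (fun k : ℕ => x ^ k / (k.factorial : ℝ)) (exp x) := by
  rw [exp_eq_exp_ℝ]
  exact NormedSpace.expSeries_div_hasSum_exp x

lemma hasSum_factorialMoment_two (x : ℝ) :
    HasSum (fun k : ℕ => (k : ℝ) * (k - 1) * (x ^ k / k.factorial)) (x ^ 2 * exp x) := by
  rw [← hasSum_nat_add_iff' 2]
  convert (hasSum_pow_div_factorial x).mul_left (x ^ 2) using 1
  · rfl
  · funext k
    have : (k.factorial : ℝ) ≠ 0 := by positivity
    rw [Nat.factorial_succ, Nat.factorial_succ]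
    push_cast
    field_simp
    ring
  · simp [Finset.sum_range_succ]

/-- A summable majorant, of total mass `3`, for the normalised `p`-th moment terms. -/
noncomputable def momentMajorant (x : ℝ) (k : ℕ) : ℝ :=
  (if k = 0 then 1 else 0) +
    exp (-x) * (x ^ k / k.factorial + (x ^ 2)⁻¹ * ((k : ℝ) * (k - 1) * (x ^ k / k.factorial)))

lemma hasSum_momentMajorant {x : ℝ} (hx : x ≠ 0) : HasSum (momentMajorant x) 3 := by
  have h1 : HasSum (fun k : ℕ => if k = 0 then (1 : ℝ) else 0) 1 := hasSum_ite_eq 0 1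
  convert h1.add (((hasSum_pow_div_factorial x).add ((hasSum_factorialMoment_two x).mul_left (x ^ 2)⁻¹)).mul_left
    (exp (-x))) using 1
  · rfl
  · have he : exp (-x) * exp x = 1 := by rw [← exp_add]; simp
    rw [inv_mul_cancel_left₀ (pow_ne_zero 2 hx), mul_add, he]
    norm_num

lemma cast_mul_cast_sub_one_nonneg (k : ℕ) : 0 ≤ (k : ℝ) * (k - 1) := by
  rcases k with _ | k
  · simp
  · push_cast
    rw [add_sub_cancel_right]
    positivity

lemma momentMajorant_nonneg {x : ℝ} (hx : 0 ≤ x) (k : ℕ) : 0 ≤ momentMajorant x k := by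
  have := cast_mul_cast_sub_one_nonneg k
  unfold momentMajorant
  split_ifs <;> positivity

lemma rpow_le_one_add_sq {t p : ℝ} (ht : 0 ≤ t) (hp0 : 0 ≤ p) (hp2 : p ≤ 2) :
    t ^ p ≤ 1 + t ^ 2 := by
  rcases le_total t 1 with h | h
  · linarith [rpow_le_one ht h hp0, sq_nonneg t]
  · have := rpow_le_rpow_of_exponent_le h hp2
    rw [rpow_two] at this
    linarith

lemma moment_term_le_majorant {x p : ℝ} (hx : 1 ≤ x) (hp1 : 1 ≤ p) (hp2 : p ≤ 2) (k : ℕ) :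
    |((k : ℝ) - 1) / x| ^ p * offspringWeight k x ≤ momentMajorant x k := by
  have hx0 : 0 < x := by linarith
  rcases Nat.eq_zero_or_pos k with rfl | hk
  · have hinv : x⁻¹ ^ p ≤ x⁻¹ :=
      rpow_le_self_of_le_one (by positivity) (inv_le_one_of_one_le₀ hx) hp1
    have hw : offspringWeight 0 x ≤ x := by
      have : exp (-x) ≤ 1 := exp_le_one_iff.2 (by linarith)
      simp only [offspringWeight, if_true]
      linarith
    have habs : |(((0 : ℕ) : ℝ) - 1) / x| = x⁻¹ := by
      rw [abs_div, abs_of_pos hx0]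
      simp
    rw [habs]
    calc x⁻¹ ^ p * offspringWeight 0 x ≤ x⁻¹ * x :=
          mul_le_mul hinv hw (offspringWeight_nonneg 0 hx0.le) (by positivity)
      _ = 1 := inv_mul_cancel₀ hx0.ne'
      _ ≤ momentMajorant x 0 := by
          simp only [momentMajorant, if_true]
          simp
          positivity
  · have hk1 : (1 : ℝ) ≤ k := by exact_mod_cast hk
    have hle : |((k : ℝ) - 1) / x| ^ p ≤ 1 + (x ^ 2)⁻¹ * (k * (k - 1)) := by
      refine (rpow_le_one_add_sq (abs_nonneg _) (by linarith) hp2).trans ?_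
      rw [sq_abs, div_pow, div_eq_inv_mul]
      gcongr
      nlinarith
    calc |((k : ℝ) - 1) / x| ^ p * offspringWeight k x
        ≤ (1 + (x ^ 2)⁻¹ * (k * (k - 1))) * offspringWeight k x :=
          mul_le_mul_of_nonneg_right hle (offspringWeight_nonneg k hx0.le)
      _ = momentMajorant x k := by
          simp only [momentMajorant, offspringWeight, if_neg hk.ne']
          ring

lemma sum_moment_term_le {N z p : ℝ} (hN : 1 ≤ N) (hz : 1 ≤ z) (hp1 : 1 ≤ p) (hp2 : p ≤ 2)
    (s : Finset ℕ) :
    ∑ k ∈ s, |((k : ℝ) - 1) / N| ^ p * offspringWeight k (N * z) ≤ 3 * z ^ p := by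
  have hx : 1 ≤ N * z := one_le_mul_of_one_le_of_one_le hN hz
  have hx0 : 0 < N * z := by linarith
  have hz0 : 0 < z := by linarith
  have hsplit : ∀ k : ℕ, |((k : ℝ) - 1) / N| ^ p = z ^ p * |((k : ℝ) - 1) / (N * z)| ^ p := by
    intro k
    rw [← mul_rpow hz0.le (abs_nonneg _)]
    congr 1
    rw [← div_div, abs_div _ z, abs_of_pos hz0, mul_div_cancel₀ _ hz0.ne']
  calc ∑ k ∈ s, |((k : ℝ) - 1) / N| ^ p * offspringWeight k (N * z)
      ≤ ∑ k ∈ s, z ^ p * momentMajorant (N * z) k := by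
        refine Finset.sum_le_sum fun k _ => ?_
        rw [hsplit, mul_assoc]
        exact mul_le_mul_of_nonneg_left (moment_term_le_majorant hx hp1 hp2 k) (by positivity)
    _ = z ^ p * ∑ k ∈ s, momentMajorant (N * z) k := (Finset.mul_sum ..).symm
    _ ≤ z ^ p * 3 := mul_le_mul_of_nonneg_left
        (sum_le_hasSum s (fun k _ => momentMajorant_nonneg hx0.le k)
          (hasSum_momentMajorant hx0.ne')) (by positivity)
    _ = 3 * z ^ p := mul_comm _ _

lemma integrableOn_rpow_Ioi_one {μ : Measure ℝ} {p : ℝ} (hp2 : p ≤ 2)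
    (hμ : IntegrableOn (fun z : ℝ => min (z ^ p) (z ^ 2)) (Ioi 0) μ) :
    IntegrableOn (fun z : ℝ => z ^ p) (Ioi 1) μ := by
  refine (hμ.mono_set (Ioi_subset_Ioi zero_le_one)).congr_fun (fun z hz => ?_) measurableSet_Ioi
  have := rpow_le_rpow_of_exponent_le (le_of_lt (mem_Ioi.1 hz)) hp2
  rw [rpow_two] at this
  exact min_eq_left this

/-- Under assumption (H1) with `μ((1,∞)) > 0`, the scaled `p`-th absolute moments about 1
of the distributions `(q_k^{+,N})` are bounded uniformly in `N`. -/
theorem stmt8 (μ : Measure ℝ) [SigmaFinite μ] (p : ℝ) (hp1 : 1 < p) (hp2 : p < 2)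
    (hμ : IntegrableOn (fun z : ℝ => min (z ^ p) (z ^ 2)) (Ioi 0) μ)
    (hpos : 0 < μ (Ioi 1))
    (α : ℕ → ℝ)
    (hα : ∀ N : ℕ, α N = ∫ z in Ioi (1 : ℝ), z * (1 - Real.exp (-(N : ℝ) * z)) ∂μ)
    (q : ℕ → ℕ → ℝ)
    (hq0 : ∀ N : ℕ, q N 0 = ((N : ℝ) * α N)⁻¹ *
      ∫ z in Ioi (1 : ℝ), (Real.exp (-(N : ℝ) * z) - 1 + (N : ℝ) * z) ∂μ)
    (hq1 : ∀ N : ℕ, q N 1 = 0)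
    (hqk : ∀ N k : ℕ, 2 ≤ k → q N k = ((k.factorial : ℝ) * ((N : ℝ) * α N))⁻¹ *
      ∫ z in Ioi (1 : ℝ), ((N : ℝ) * z) ^ k * Real.exp (-(N : ℝ) * z) ∂μ) :
    ∃ C₂ : ℝ, 0 < C₂ ∧ ∀ N : ℕ, 1 ≤ N →
      (N : ℝ) * α N * ∑' k : ℕ, |((k : ℝ) - 1) / N| ^ p * q N k ≤ C₂ := by
  have hint := integrableOn_rpow_Ioi_one hp2.le hμ
  have hM : 0 ≤ ∫ z in Ioi (1 : ℝ), 3 * z ^ p ∂μ :=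
    setIntegral_nonneg measurableSet_Ioi fun z hz => by
      have : (0 : ℝ) < z := zero_lt_one.trans hz
      positivity
  refine ⟨(∫ z in Ioi (1 : ℝ), 3 * z ^ p ∂μ) + 1, by linarith, fun N hN => ?_⟩
  have hN1 : (1 : ℝ) ≤ N := by exact_mod_cast hN
  by_cases hA : (N : ℝ) * α N = 0
  · rw [hA, zero_mul]
    linarith
  let f : ℕ → ℝ → ℝ := fun k z => |((k : ℝ) - 1) / N| ^ p * offspringWeight k (N * z)
  have hterm : ∀ k : ℕ, (N : ℝ) * α N * (|((k : ℝ) - 1) / N| ^ p * q N k) =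
      ∫ z in Ioi (1 : ℝ), f k z ∂μ := by
    intro k
    simp only [f]
    rw [integral_const_mul, mul_left_comm]
    rcases k with _ | _ | k
    · rw [hq0, mul_inv_cancel_left₀ hA]
      simp [offspringWeight]
    · simp [zero_rpow (zero_lt_one.trans hp1).ne']
    · rw [hqk N _ (by omega)]
      simp only [offspringWeight, if_neg (Nat.succ_ne_zero _), integral_const_mul]
      rw [mul_inv, mul_assoc (_⁻¹), mul_left_comm ((N : ℝ) * α N), mul_inv_cancel_left₀ hA]
      simp only [neg_mul]
  have hsum : ∀ s : Finset ℕ, ∀ z ∈ Ioi (1 : ℝ), ∑ k ∈ s, f k z ≤ 3 * z ^ p :=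
    fun s z hz => sum_moment_term_le hN1 (le_of_lt hz) hp1.le hp2.le s
  have hf : ∀ k, IntegrableOn (f k) (Ioi 1) μ := by
    intro k
    refine (hint.const_mul 3).mono' ?_ ?_
    · exact (((measurable_offspringWeight k).comp
        (measurable_const_mul (N : ℝ))).const_mul _).aestronglyMeasurable
    · refine (ae_restrict_iff' measurableSet_Ioi).2 (.of_forall fun z hz => ?_)
      have hz0 : (0 : ℝ) < z := zero_lt_one.trans hz
      have hw := offspringWeight_nonneg k (x := N * z) (by positivity)
      rw [norm_of_nonneg (by positivity)]
      simpa using hsum {k} z hz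
  rw [← tsum_mul_left]
  refine (tsum_le_of_sum_le' hM fun s => ?_).trans (le_add_of_nonneg_right zero_le_one)
  simp only [hterm]
  rw [← integral_finsetSum s fun k _ => hf k]
  exact setIntegral_mono_on (integrable_finsetSum s fun k _ => hf k) (hint.const_mul 3)
    measurableSet_Ioi (hsum s)
end

section
/- Let p ∈ (1,2), let f : [0,∞) → ℝ satisfy assumption (H2) with constant β > 0, and let G : [0,∞) → ℝ be differentiable with 0 ≤ G′(z) ≤ C₀ z^{p−1} for all z > 0 (for some C₀ > 0) and G′(z) = p z^{p−1} for all z > 1. Then there exists a constant C > 0 such that for all z ≥ 0: G′(z) f(z) ≤ C (1 + z^{p}) − p z^{p−1} f⁻(z), where f⁻(z) = max(−f(z), 0). -/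
open Real Set

/-- If `f` satisfies (H2) and `G` is differentiable with `0 ≤ G′(z) ≤ C₀ z^{p−1}` for
`z > 0` and `G′(z) = p z^{p−1}` for `z > 1`, then there is `C > 0` such that
`G′(z) f(z) ≤ C(1 + z^p) − p z^{p−1} f⁻(z)` for all `z ≥ 0`. -/
theorem stmt12 (p : ℝ) (hp1 : 1 < p) (hp2 : p < 2)
    (f : ℝ → ℝ) (β : ℝ) (hβ : 0 < β)
    (hf_cont : ContinuousOn f (Ici 0)) (hf0 : f 0 = 0)
    (hf : ∀ x y : ℝ, 0 ≤ x → 0 ≤ y → f (x + y) - f x ≤ β * y)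
    (G : ℝ → ℝ) (C₀ : ℝ) (hC₀ : 0 < C₀)
    (hGdiff : ∀ z : ℝ, 0 < z → DifferentiableAt ℝ G z)
    (hG' : ∀ z : ℝ, 0 < z → 0 ≤ deriv G z ∧ deriv G z ≤ C₀ * z ^ (p - 1))
    (hG'1 : ∀ z : ℝ, 1 < z → deriv G z = p * z ^ (p - 1)) :
    ∃ C : ℝ, 0 < C ∧ ∀ z : ℝ, 0 ≤ z →
      deriv G z * f z ≤ C * (1 + z ^ p) - p * z ^ (p - 1) * max (-f z) 0 := by
  obtain ⟨M, hM⟩ := isCompact_Icc.exists_bound_of_continuousOn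
    (hf_cont.mono (Icc_subset_Ici_self : Icc (0 : ℝ) 1 ⊆ Ici 0))
  have hM0 : 0 ≤ M := (norm_nonneg _).trans (hM 0 (by simp))
  have hp0 : 0 < p := by linarith
  have hCpos : 0 < p * β + (C₀ + p) * M := by positivity
  refine ⟨p * β + (C₀ + p) * M, hCpos, fun z hz => ?_⟩
  have hzp : 0 ≤ z ^ p := rpow_nonneg hz p
  rcases hz.eq_or_lt with rfl | hz
  · rw [hf0, zero_rpow hp0.ne']
    simpa using hCpos.le
  have hzq : 0 ≤ z ^ (p - 1) := rpow_nonneg hz.le _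
  rcases le_or_gt z 1 with hz1 | hz1
  · have hq1 : z ^ (p - 1) ≤ 1 := rpow_le_one hz.le hz1 (by linarith)
    obtain ⟨hfl, hfu⟩ := abs_le.mp (hM z ⟨hz.le, hz1⟩)
    obtain ⟨hG0, hGle⟩ := hG' z hz
    have hGC : deriv G z ≤ C₀ := hGle.trans (mul_le_of_le_one_right hC₀.le hq1)
    have hGf : deriv G z * f z ≤ C₀ * M :=
      (mul_le_mul_of_nonneg_left hfu hG0).trans (mul_le_mul_of_nonneg_right hGC hM0)
    have hneg : p * z ^ (p - 1) * max (-f z) 0 ≤ p * M :=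
      mul_le_mul (mul_le_of_le_one_right hp0.le hq1) (max_le (by linarith) hM0)
        (le_max_right _ _) hp0.le
    nlinarith [mul_nonneg hCpos.le hzp, mul_pos hp0 hβ]
  · have hfz : f z ≤ β * z := by simpa [hf0] using hf 0 z le_rfl hz.le
    have hpos : f z + max (-f z) 0 ≤ β * z := by
      rcases max_cases (-f z) 0 with ⟨h, _⟩ | ⟨h, _⟩ <;> rw [h]
      · rw [add_neg_cancel]; positivity
      · simpa using hfz
    have hpow : z ^ (p - 1) * z = z ^ p := by
      rw [rpow_sub_one hz.ne', div_mul_cancel₀ _ hz.ne']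
    have hmul : p * z ^ (p - 1) * (f z + max (-f z) 0) ≤ p * β * z ^ p := by
      calc p * z ^ (p - 1) * (f z + max (-f z) 0) ≤ p * z ^ (p - 1) * (β * z) := by gcongr
        _ = p * β * z ^ p := by rw [← hpow]; ring
    have hMz : 0 ≤ (C₀ + p) * M * z ^ p := by positivity
    rw [hG'1 z hz1]
    linarith
end
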